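/- arXiv:1203.0021 — 3 statements merged into one kernel-verified Lean document; each statement's English description precedes it below -/
import Mathlib

section
/- Assume 𝒥 is independent, P ⊆ G satisfies the Toeplitz condition, and P is not left reversible, i.e. there exist p, q ∈ P with (pP) ∩ (qP) = ∅. Then the right G-action on (∂Σ)·G is a local boundary action: for every nonempty open subset U of (∂Σ)·G there exist an open subset Δ ⊆ U and an element g ∈ G such that cl(Δ)·g ⊊ Δ, where cl(Δ) denotes the closure of Δ in (∂Σ)·G. -/
variable {G : Type*} [Group G]

/-- Left translate `g·X = {gx : x ∈ X}`. -/
def lmul (g : G) (X : Set G) : Set G := (g * ·) '' X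

/-- `p⁻¹X = {y ∈ P : py ∈ X}`. -/
def presub (P : Submonoid G) (p : G) (X : Set G) : Set G := {y : G | y ∈ P ∧ p * y ∈ X}

/-- The constructible right ideals of `P`: the smallest family of subsets of `P`
containing `∅` and `P` and closed under `X ↦ pX` and `X ↦ p⁻¹X` for `p ∈ P`. -/
inductive IsConstructible (P : Submonoid G) : Set G → Prop
  | empty : IsConstructible P ∅
  | base : IsConstructible P (P : Set G)
  | mul {p : G} (hp : p ∈ P) {X : Set G} (hX : IsConstructible P X) : IsConstructible P (lmul p X)
  | pre {p : G} (hp : p ∈ P) {X : Set G} (hX : IsConstructible P X) :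
      IsConstructible P (presub P p X)

/-- `𝒥_P^G`: the smallest family of subsets of `G` containing `𝒥`, closed under left
translations by group elements and under finite intersections. -/
inductive IsConstructibleG (P : Submonoid G) : Set G → Prop
  | base {X : Set G} (hX : IsConstructible P X) : IsConstructibleG P X
  | translate (g : G) {Y : Set G} (hY : IsConstructibleG P Y) : IsConstructibleG P (lmul g Y)
  | inter {Y₁ Y₂ : Set G} (h1 : IsConstructibleG P Y₁) (h2 : IsConstructibleG P Y₂) :
      IsConstructibleG P (Y₁ ∩ Y₂)

/-- A family of subsets (containing `∅` and closed under finite intersections) is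
independent if whenever a member equals a finite union of members, it equals one of them. -/
def IsIndepFamily {α : Type*} (J : Set (Set α)) : Prop :=
  ∀ X ∈ J, ∀ n : ℕ, 0 < n → ∀ Xs : Fin n → Set α,
    (∀ i, Xs i ∈ J) → X = ⋃ i, Xs i → ∃ i, X = Xs i

/-- The Toeplitz condition for `P ⊆ G` (set-theoretic form): for every `g ∈ G` with
`{x ∈ P : gx ∈ P} ≠ ∅` there are `p₁, q₁, …, pₙ, qₙ ∈ P` (`n ≥ 1`) with
`g = p₁⁻¹q₁⋯pₙ⁻¹qₙ` and `{x ∈ P : gx ∈ P} = qₙ⁻¹(pₙ(⋯(q₁⁻¹(p₁P))⋯))`. -/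
def IsToeplitz (P : Submonoid G) : Prop :=
  ∀ g : G, {x : G | x ∈ P ∧ g * x ∈ P}.Nonempty →
    ∃ l : List (G × G), l ≠ [] ∧ (∀ pq ∈ l, pq.1 ∈ P ∧ pq.2 ∈ P) ∧
      g = (l.map fun pq => pq.1⁻¹ * pq.2).prod ∧
      {x : G | x ∈ P ∧ g * x ∈ P} =
        l.foldl (fun S pq => presub P pq.2 (lmul pq.1 S)) (P : Set G)

/-- A `J`-valued filter. -/
def IsFilterOn {α : Type*} (J : Set (Set α)) (F : Set (Set α)) : Prop :=
  F ⊆ J ∧ (∀ X₁ ∈ F, ∀ X₂ ∈ J, X₁ ⊆ X₂ → X₂ ∈ F) ∧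
    (∀ X₁ ∈ F, ∀ X₂ ∈ F, X₁ ∩ X₂ ∈ F) ∧ ∅ ∉ F

open Classical in
/-- Indicator function of a family of sets, with values in the discrete space `Bool`;
this realizes a family as a point of the product space `{0,1}^(Set α)`. -/
noncomputable def chiF {α : Type*} (F : Set (Set α)) : Set α → Bool :=
  fun X => if X ∈ F then true else false

/-- `Σ`, the space of nonempty `𝒥`-valued filters, topologized as a subspace of
`{0,1}^𝒥` via indicator functions. -/
def SigmaT (P : Submonoid G) : Type _ :=
  {F : Set (Set G) // IsFilterOn {X : Set G | IsConstructible P X} F ∧ F.Nonempty}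

noncomputable instance (P : Submonoid G) : TopologicalSpace (SigmaT P) :=
  TopologicalSpace.induced (fun F : SigmaT P => chiF F.1) inferInstance

/-- `pℱ = {X ∈ 𝒥 : p⁻¹X ∈ ℱ}`. -/
def fwdF (P : Submonoid G) (p : G) (F : Set (Set G)) : Set (Set G) :=
  {X : Set G | IsConstructible P X ∧ presub P p X ∈ F}

/-- `p⁻¹𝒢 = {X ∈ 𝒥 : pX ∈ 𝒢}`. -/
def bwdF (P : Submonoid G) (p : G) (F : Set (Set G)) : Set (Set G) :=
  {X : Set G | IsConstructible P X ∧ lmul p X ∈ F}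

/-- `ℱ` is a `𝒥`-valued ultrafilter: a maximal element of `Σ` w.r.t. inclusion. -/
def IsUltraFilterOn (P : Submonoid G) (F : Set (Set G)) : Prop :=
  (IsFilterOn {X : Set G | IsConstructible P X} F ∧ F.Nonempty) ∧
    ∀ F' : Set (Set G), IsFilterOn {X : Set G | IsConstructible P X} F' → F'.Nonempty →
      F ⊆ F' → F' = F

/-- `Σ^G`, the space of nonempty `𝒥_P^G`-valued filters, topologized as a subspace of
`{0,1}^{𝒥_P^G}` via indicator functions. -/
def SigmaGT (P : Submonoid G) : Type _ :=
  {F : Set (Set G) // IsFilterOn {Y : Set G | IsConstructibleG P Y} F ∧ F.Nonempty}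

noncomputable instance (P : Submonoid G) : TopologicalSpace (SigmaGT P) :=
  TopologicalSpace.induced (fun F : SigmaGT P => chiF F.1) inferInstance

/-- The right `G`-action on `𝒥_P^G`-valued filters: `ℱ̂·g = {Y ∈ 𝒥_P^G : g·Y ∈ ℱ̂}`. -/
def actG (P : Submonoid G) (g : G) (F : Set (Set G)) : Set (Set G) :=
  {Y : Set G | IsConstructibleG P Y ∧ lmul g Y ∈ F}

/-- `ι(ℱ) = {Y ∈ 𝒥_P^G : Y ∩ P ∈ ℱ}`, embedding `𝒥`-valued filters into `𝒥_P^G`-valued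
filters. -/
def iotaF (P : Submonoid G) (F : Set (Set G)) : Set (Set G) :=
  {Y : Set G | IsConstructibleG P Y ∧ (Y ∩ (P : Set G)) ∈ F}

/-- The boundary space `(∂Σ)·G = {ι(ℱ)·g : ℱ ∈ ∂Σ, g ∈ G} ⊆ Σ^G`, where
`∂Σ = closure Σ_max`. -/
def bdOrbit (P : Submonoid G) : Set (SigmaGT P) :=
  {Fh : SigmaGT P | ∃ F : SigmaT P,
    F ∈ closure {E : SigmaT P | IsUltraFilterOn P E.1} ∧
      ∃ g : G, Fh.1 = actG P g (iotaF P F.1)}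

/-- `G₀ = {g ∈ G : (g·P) ∩ X ≠ ∅ and (g⁻¹·P) ∩ X ≠ ∅ for all nonempty X ∈ 𝒥}`. -/
def Gzero (P : Submonoid G) : Set G :=
  {g : G | ∀ X : Set G, IsConstructible P X → X.Nonempty →
    (lmul g (P : Set G) ∩ X).Nonempty ∧ (lmul g⁻¹ (P : Set G) ∩ X).Nonempty}

theorem mem_lmul {g x : G} {X : Set G} : x ∈ lmul g X ↔ g⁻¹ * x ∈ X := by
  constructor
  · rintro ⟨y, hy, rfl⟩
    simpa using hy
  · intro h
    exact ⟨g⁻¹ * x, h, by simp⟩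

theorem lmul_lmul (g h : G) (X : Set G) : lmul g (lmul h X) = lmul (g * h) X := by
  ext x
  simp [mem_lmul, mul_assoc]

theorem lmul_one (X : Set G) : lmul 1 X = X := by
  ext x
  simp [mem_lmul]

theorem lmul_inter (g : G) (X Y : Set G) : lmul g (X ∩ Y) = lmul g X ∩ lmul g Y := by
  ext x
  simp [mem_lmul]

theorem lmul_mono (g : G) {X Y : Set G} (h : X ⊆ Y) : lmul g X ⊆ lmul g Y :=
  Set.image_mono h

theorem lmul_empty (g : G) : lmul g (∅ : Set G) = ∅ :=
  Set.image_empty _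

theorem lmul_self_subset {P : Submonoid G} {p : G} (hp : p ∈ P) :
    lmul p (P : Set G) ⊆ (P : Set G) := by
  rintro _ ⟨y, hy, rfl⟩
  exact P.mul_mem hp hy

theorem chiF_eq_true {α : Type*} {F : Set (Set α)} {X : Set α} :
    chiF F X = true ↔ X ∈ F := by
  simp [chiF]

theorem chiF_apply_congr {α : Type*} {F F' : Set (Set α)} {X X' : Set α}
    (h : X ∈ F ↔ X' ∈ F') : chiF F X = chiF F' X' := by
  simp [chiF, h]

namespace IsConstructible

variable {P : Submonoid G} {X Y : Set G}

theorem subset (hX : IsConstructible P X) : X ⊆ (P : Set G) := by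
  induction hX with
  | empty => exact Set.empty_subset _
  | base => exact subset_rfl
  | mul hp _ ih => exact (lmul_mono _ ih).trans (lmul_self_subset hp)
  | pre hp _ ih => exact fun y hy => hy.1

theorem mul_mem (hX : IsConstructible P X) {x y : G} (hx : x ∈ X) (hy : y ∈ P) :
    x * y ∈ X := by
  induction hX generalizing x with
  | empty => exact hx
  | base => exact P.mul_mem hx hy
  | mul hp _ ih =>
    rw [mem_lmul] at hx ⊢
    rw [← mul_assoc]
    exact ih hx
  | pre hp _ ih =>
    refine ⟨P.mul_mem hx.1 hy, ?_⟩
    rw [← mul_assoc]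
    exact ih hx.2

theorem lmul_subset (hX : IsConstructible P X) {x : G} (hx : x ∈ X) :
    lmul x (P : Set G) ⊆ X := by
  rintro _ ⟨y, hy, rfl⟩
  exact hX.mul_mem hx hy

theorem inter (hX : IsConstructible P X) (hY : IsConstructible P Y) :
    IsConstructible P (X ∩ Y) := by
  induction hX generalizing Y with
  | empty => simpa using IsConstructible.empty
  | base => rwa [Set.inter_eq_self_of_subset_right hY.subset]
  | @mul p hp X hX ih =>
    have key : lmul p X ∩ Y = lmul p (X ∩ presub P p Y) := by
      ext x
      simp only [Set.mem_inter_iff, mem_lmul, presub, Set.mem_ofPred_eq, mul_inv_cancel_left]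
      exact ⟨fun h => ⟨h.1, hX.subset h.1, h.2⟩, fun h => ⟨h.1, h.2.2⟩⟩
    rw [key]
    exact (ih (hY.pre hp)).mul hp
  | @pre p hp X hX ih =>
    have key : presub P p X ∩ Y = presub P p (X ∩ lmul p Y) := by
      ext x
      simp only [Set.mem_inter_iff, mem_lmul, presub, Set.mem_ofPred_eq, inv_mul_cancel_left]
      tauto
    rw [key]
    exact (ih (hY.mul hp)).pre hp

theorem foldl (l : List (G × G)) (hl : ∀ pq ∈ l, pq.1 ∈ P ∧ pq.2 ∈ P)
    (hX : IsConstructible P X) :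
    IsConstructible P (l.foldl (fun S pq => presub P pq.2 (lmul pq.1 S)) X) := by
  induction l generalizing X with
  | nil => exact hX
  | cons a l ih =>
    have ha := hl a (by simp)
    exact ih (fun pq h => hl pq (by simp [h])) ((hX.mul ha.1).pre ha.2)

end IsConstructible

theorem foldl_presub_inter (P : Submonoid G) (l : List (G × G)) (S X : Set G) (g : G) :
    l.foldl (fun S pq => presub P pq.2 (lmul pq.1 S)) (S ∩ {x | g * x ∈ X}) =
      l.foldl (fun S pq => presub P pq.2 (lmul pq.1 S)) S ∩
        {x | g * (l.map fun pq => pq.1⁻¹ * pq.2).prod * x ∈ X} := by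
  induction l generalizing S g with
  | nil => simp
  | cons a l ih =>
    have key : presub P a.2 (lmul a.1 (S ∩ {x | g * x ∈ X})) =
        presub P a.2 (lmul a.1 S) ∩ {x | g * (a.1⁻¹ * a.2) * x ∈ X} := by
      ext x
      simp only [Set.mem_inter_iff, mem_lmul, presub, Set.mem_ofPred_eq, mul_assoc]
      tauto
    rw [List.foldl_cons, List.foldl_cons, key, ih, List.map_cons, List.prod_cons, mul_assoc g]

theorem IsToeplitz.lmul_inter_isConstructible {P : Submonoid G} (hT : IsToeplitz P) {X : Set G}
    (hX : IsConstructible P X) (g : G) : IsConstructible P (lmul g X ∩ (P : Set G)) := by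
  by_cases hne : {x : G | x ∈ P ∧ g⁻¹ * x ∈ P}.Nonempty
  · obtain ⟨l, -, hl, hprod, hset⟩ := hT g⁻¹ hne
    have hfold := hX.foldl l hl
    have key := foldl_presub_inter P l (P : Set G) X 1
    have hPX : (P : Set G) ∩ {x | 1 * x ∈ X} = X := by
      ext x
      simpa using fun h => hX.subset h
    rw [hPX, ← hset, one_mul, ← hprod] at key
    rw [key] at hfold
    convert hfold using 1
    ext x
    simp only [Set.mem_inter_iff, mem_lmul, Set.mem_ofPred_eq, SetLike.mem_coe]
    exact ⟨fun h => ⟨⟨h.2, hX.subset h.1⟩, h.1⟩, fun h => ⟨h.2, h.1.1⟩⟩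
  · have key : lmul g X ∩ (P : Set G) = ∅ := by
      ext x
      simp only [Set.mem_inter_iff, mem_lmul, Set.mem_empty_iff_false, iff_false]
      exact fun h => hne ⟨x, h.2, hX.subset h.1⟩
    rw [key]
    exact .empty

theorem IsToeplitz.lmul_inter_isConstructible_of_isConstructibleG {P : Submonoid G}
    (hT : IsToeplitz P) {Y : Set G} (hY : IsConstructibleG P Y) (g : G) :
    IsConstructible P (lmul g Y ∩ (P : Set G)) := by
  induction hY generalizing g with
  | base hX => exact hT.lmul_inter_isConstructible hX g
  | translate h _ ih =>
    rw [lmul_lmul]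
    exact ih _
  | inter _ _ ih₁ ih₂ =>
    rw [lmul_inter, Set.inter_inter_distrib_right]
    exact (ih₁ g).inter (ih₂ g)

theorem IsUltraFilterOn.exists_inter_eq_empty {P : Submonoid G} {F : Set (Set G)}
    (hF : IsUltraFilterOn P F) {B : Set G} (hB : IsConstructible P B) (hBF : B ∉ F) :
    ∃ X ∈ F, X ∩ B = ∅ := by
  obtain ⟨⟨⟨hsub, hup, hint, hempty⟩, X₀, hX₀⟩, hmax⟩ := hF
  by_contra! hcon
  let F' : Set (Set G) := {Z | IsConstructible P Z ∧ ∃ X ∈ F, X ∩ B ⊆ Z}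
  have hBF' : B ∈ F' := ⟨hB, X₀, hX₀, Set.inter_subset_right⟩
  have hF' : IsFilterOn {X : Set G | IsConstructible P X} F' := by
    refine ⟨fun Z hZ => hZ.1, ?_, ?_, ?_⟩
    · rintro Z ⟨-, X, hX, hXZ⟩ Z' hZ' hZZ'
      exact ⟨hZ', X, hX, hXZ.trans hZZ'⟩
    · rintro Z ⟨hZ, X, hX, hXZ⟩ Z' ⟨hZ', X', hX', hXZ'⟩
      exact ⟨hZ.inter hZ', X ∩ X', hint X hX X' hX',
        fun x hx => ⟨hXZ ⟨hx.1.1, hx.2⟩, hXZ' ⟨hx.1.2, hx.2⟩⟩⟩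
    · rintro ⟨-, X, hX, hXZ⟩
      exact (hcon X hX).ne_empty (Set.subset_empty_iff.mp hXZ)
  have hFF' : F ⊆ F' := fun X hX => ⟨hsub hX, X, hX, Set.inter_subset_left⟩
  exact hBF (hmax F' hF' ⟨B, hBF'⟩ hFF' ▸ hBF')

theorem SigmaT.coe_mem {P : Submonoid G} (F : SigmaT P) : (P : Set G) ∈ F.1 := by
  obtain ⟨X, hX⟩ := F.2.2
  exact F.2.1.2.1 X hX _ .base (IsConstructible.subset (F.2.1.1 hX))

theorem mem_actG_iotaF {P : Submonoid G} {g : G} {F : Set (Set G)} {Y : Set G} :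
    Y ∈ actG P g (iotaF P F) ↔ IsConstructibleG P Y ∧ lmul g Y ∩ (P : Set G) ∈ F :=
  ⟨fun h => ⟨h.1, h.2.2⟩, fun h => ⟨h.1, h.1.translate g, h.2⟩⟩

/-- The point `ι(ℱ)·g` of `Σ^G`. -/
def SigmaT.orbitPoint {P : Submonoid G} (hT : IsToeplitz P) (g : G) (F : SigmaT P) :
    SigmaGT P := by
  refine ⟨actG P g (iotaF P F.1), ⟨fun Y hY => hY.1, ?_, ?_, ?_⟩, lmul g⁻¹ P, ?_⟩
  · intro Y hY Z hZ hYZ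
    rw [mem_actG_iotaF] at hY ⊢
    exact ⟨hZ, F.2.1.2.1 _ hY.2 _ (hT.lmul_inter_isConstructible_of_isConstructibleG hZ g)
      (Set.inter_subset_inter_left _ (lmul_mono g hYZ))⟩
  · intro Y hY Z hZ
    rw [mem_actG_iotaF] at hY hZ ⊢
    refine ⟨hY.1.inter hZ.1, ?_⟩
    rw [lmul_inter, Set.inter_inter_distrib_right]
    exact F.2.1.2.2.1 _ hY.2 _ hZ.2
  · rw [mem_actG_iotaF, lmul_empty, Set.empty_inter]
    exact fun h => F.2.1.2.2.2 h.2
  · rw [mem_actG_iotaF, lmul_lmul, mul_inv_cancel, lmul_one, Set.inter_self]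
    exact ⟨.translate _ (.base .base), F.coe_mem⟩

theorem continuous_chiF_sigmaT (P : Submonoid G) (X : Set G) :
    Continuous fun F : SigmaT P => chiF F.1 X :=
  (continuous_apply X).comp
    (continuous_induced_dom : Continuous fun F : SigmaT P => chiF F.1)

theorem continuous_chiF_sigmaGT (P : Submonoid G) (Y : Set G) :
    Continuous fun F : SigmaGT P => chiF F.1 Y :=
  (continuous_apply Y).comp
    (continuous_induced_dom : Continuous fun F : SigmaGT P => chiF F.1)

theorem SigmaT.continuous_orbitPoint {P : Submonoid G} (hT : IsToeplitz P) (g : G) :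
    Continuous (SigmaT.orbitPoint hT g) := by
  refine continuous_induced_rng.mpr (continuous_pi fun Y => ?_)
  by_cases hY : IsConstructibleG P Y
  · refine (continuous_chiF_sigmaT P (lmul g Y ∩ P)).congr fun F => chiF_apply_congr ?_
    exact (mem_actG_iotaF.trans (and_iff_right hY)).symm
  · refine (continuous_const (y := false)).congr fun F => ?_
    have : Y ∉ (SigmaT.orbitPoint hT g F).1 := fun h => hY h.1
    simp [chiF, this]

theorem SigmaGT.isClopen_mem (P : Submonoid G) (S : Set (SigmaGT P)) (D : Set G) :
    IsClopen {z : ↥S | D ∈ z.1.1} := by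
  have h : {z : ↥S | D ∈ z.1.1} = (fun z : ↥S => chiF z.1.1 D) ⁻¹' {true} := by
    ext z
    exact chiF_eq_true.symm
  rw [h]
  exact (isClopen_discrete _).preimage
    ((continuous_chiF_sigmaGT P D).comp continuous_subtype_val)

theorem IsUltraFilterOn.exists_forall_mem_iff {P : Submonoid G} (hT : IsToeplitz P) {F : SigmaT P}
    (hF : IsUltraFilterOn P F.1) (g : G) (Y : Set G) :
    ∃ X ∈ F.1, ∀ z : SigmaGT P, lmul g⁻¹ X ∈ z.1 →
      (Y ∈ z.1 ↔ Y ∈ (SigmaT.orbitPoint hT g F).1) := by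
  by_cases hY : IsConstructibleG P Y
  · have hgY := hT.lmul_inter_isConstructible_of_isConstructibleG hY g
    by_cases hmem : lmul g Y ∩ (P : Set G) ∈ F.1
    · refine ⟨_, hmem, fun z hz => iff_of_true (z.2.1.2.1 _ hz _ hY ?_)
        (mem_actG_iotaF.mpr ⟨hY, hmem⟩)⟩
      rw [lmul_inter, lmul_lmul, inv_mul_cancel, lmul_one]
      exact Set.inter_subset_left
    · obtain ⟨X, hX, hXY⟩ := hF.exists_inter_eq_empty hgY hmem
      refine ⟨X, hX, fun z hz => iff_of_false (fun hYz => z.2.1.2.2.2 ?_)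
        (fun h => hmem (mem_actG_iotaF.mp h).2)⟩
      have hdisj : X ∩ lmul g Y = ∅ := by
        rw [← hXY, Set.inter_comm (lmul g Y), ← Set.inter_assoc,
          Set.inter_eq_self_of_subset_left (IsConstructible.subset (F.2.1.1 hX))]
      have hempty : lmul g⁻¹ X ∩ Y = ∅ := by
        rw [← lmul_empty g⁻¹, ← hdisj, lmul_inter, lmul_lmul, inv_mul_cancel, lmul_one]
      exact hempty ▸ z.2.1.2.2.1 _ hz _ hYz
  · exact ⟨P, F.coe_mem, fun z _ => iff_of_false (fun h => hY (z.2.1.1 h)) (fun h => hY h.1)⟩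

theorem IsUltraFilterOn.exists_forall_mem_of_isOpen {P : Submonoid G} (hT : IsToeplitz P)
    {F : SigmaT P} (hF : IsUltraFilterOn P F.1) (g : G) {V : Set (SigmaGT P)} (hV : IsOpen V)
    (hFV : SigmaT.orbitPoint hT g F ∈ V) :
    ∃ X ∈ F.1, ∀ z : SigmaGT P, lmul g⁻¹ X ∈ z.1 → z ∈ V := by
  obtain ⟨W, hW, rfl⟩ := isOpen_induced_iff.mp hV
  obtain ⟨I, u, hu, hIW⟩ := isOpen_pi_iff.mp hW _ hFV
  suffices h : ∀ I : Finset (Set G), ∃ X ∈ F.1, ∀ z : SigmaGT P, lmul g⁻¹ X ∈ z.1 →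
      ∀ Y ∈ I, (Y ∈ z.1 ↔ Y ∈ (SigmaT.orbitPoint hT g F).1) by
    obtain ⟨X, hX, hXI⟩ := h I
    refine ⟨X, hX, fun z hz => hIW fun Y hY => ?_⟩
    have hzY : chiF z.1 Y ∈ u Y := by
      rw [chiF_apply_congr (hXI z hz Y hY)]
      exact (hu Y hY).2
    exact hzY
  intro I
  induction I using Finset.cons_induction with
  | empty => exact ⟨P, F.coe_mem, by simp⟩
  | cons Y I _ ih =>
    obtain ⟨X, hX, hXI⟩ := ih
    obtain ⟨X', hX', hXY⟩ := hF.exists_forall_mem_iff hT g Y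
    have hconstr {Z : Set G} (hZ : Z ∈ F.1) : IsConstructibleG P (lmul g⁻¹ Z) :=
      .translate _ (.base (F.2.1.1 hZ))
    refine ⟨X ∩ X', F.2.1.2.2.1 _ hX _ hX', fun z hz Z hZ => ?_⟩
    rcases Finset.mem_cons.mp hZ with rfl | hZ
    · exact hXY z (z.2.1.2.1 _ hz _ (hconstr hX') (lmul_mono _ Set.inter_subset_right))
    · exact hXI z (z.2.1.2.1 _ hz _ (hconstr hX) (lmul_mono _ Set.inter_subset_left)) Z hZ

/-- Assume `𝒥` is independent, `P ⊆ G` is Toeplitz, and `P` is not left reversible.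
Then the right `G`-action on `(∂Σ)·G` is a local boundary action: every nonempty open
`U` contains an open `Δ` with `cl(Δ)·g ⊊ Δ` for some `g ∈ G`. -/
theorem stmt_15 (P : Submonoid G)
    (hind : IsIndepFamily {X : Set G | IsConstructible P X}) (hT : IsToeplitz P)
    (hrev : ∃ p ∈ P, ∃ q ∈ P, lmul p (P : Set G) ∩ lmul q (P : Set G) = ∅) :
    ∀ U : Set ↥(bdOrbit P), U.Nonempty → IsOpen U →
      ∃ (Δ : Set ↥(bdOrbit P)) (g : G), IsOpen Δ ∧ Δ ⊆ U ∧
        {w : ↥(bdOrbit P) | ∃ z ∈ closure Δ, w.1.1 = actG P g z.1.1} ⊂ Δ := by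
  rintro U ⟨⟨w₀, F₀, hF₀, g, hw₀⟩, hwU⟩ hU
  obtain ⟨p, hp, q, hq, hpq⟩ := hrev
  obtain ⟨V, hV, rfl⟩ := isOpen_induced_iff.mp hU
  obtain rfl : w₀ = F₀.orbitPoint hT g := Subtype.ext hw₀
  obtain ⟨F, hFV, hF⟩ := mem_closure_iff.mp hF₀ _
    (hV.preimage (SigmaT.continuous_orbitPoint hT g)) hwU
  obtain ⟨X, hX, hXV⟩ := IsUltraFilterOn.exists_forall_mem_of_isOpen hT hF g hV hFV
  have hXc : IsConstructible P X := F.2.1.1 hX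
  obtain ⟨x, hx⟩ : X.Nonempty := by
    rw [Set.nonempty_iff_ne_empty]
    rintro rfl
    exact F.2.1.2.2.2 hX
  have hPG (a : G) : IsConstructibleG P (lmul a (P : Set G)) := .translate _ (.base .base)
  set d : G := g⁻¹ * x with hd
  have hdp : d * p⁻¹ * d⁻¹ * (d * p) = d := by group
  have hclopen := SigmaGT.isClopen_mem P (bdOrbit P) (lmul d P)
  refine ⟨{z | lmul d P ∈ z.1.1}, d * p⁻¹ * d⁻¹, hclopen.isOpen, ?_, ?_, ?_⟩
  · intro z hz
    refine hXV z.1 (z.1.2.1.2.1 _ hz _ (.translate _ (.base hXc)) ?_)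
    rw [hd, ← lmul_lmul]
    exact lmul_mono _ (hXc.lmul_subset hx)
  · rw [hclopen.isClosed.closure_eq]
    rintro w ⟨z, hz, hwz⟩
    have hw : lmul (d * p) (P : Set G) ∈ w.1.1 := by
      rw [hwz]
      refine ⟨hPG _, ?_⟩
      rwa [lmul_lmul, hdp]
    refine w.1.2.1.2.1 _ hw _ (hPG d) ?_
    rw [← lmul_lmul]
    exact lmul_mono _ (lmul_self_subset hp)
  · rw [hclopen.isClosed.closure_eq]
    intro hsub
    let w : ↥(bdOrbit P) := ⟨F.orbitPoint hT (d * q)⁻¹, F, subset_closure hF, _, rfl⟩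
    have hqw : lmul (d * q) (P : Set G) ∈ w.1.1 := by
      refine mem_actG_iotaF.mpr ⟨hPG _, ?_⟩
      rw [lmul_lmul, inv_mul_cancel, lmul_one, Set.inter_self]
      exact F.coe_mem
    have hdw : lmul d (P : Set G) ∈ w.1.1 := by
      refine w.1.2.1.2.1 _ hqw _ (hPG d) ?_
      rw [← lmul_lmul]
      exact lmul_mono _ (lmul_self_subset hq)
    obtain ⟨z, hz, hwz⟩ := hsub (show w ∈ {z : ↥(bdOrbit P) | lmul d P ∈ z.1.1} from hdw)
    have hpw : lmul (d * p) (P : Set G) ∈ w.1.1 := by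
      rw [hwz]
      refine ⟨hPG _, ?_⟩
      rwa [lmul_lmul, hdp]
    have hempty : lmul (d * p) (P : Set G) ∩ lmul (d * q) (P : Set G) = ∅ := by
      rw [← lmul_lmul, ← lmul_lmul d q, ← lmul_inter, hpq, lmul_empty]
    exact w.1.2.1.2.2.2 (hempty ▸ w.1.2.1.2.2.1 _ hpw _ hqw)
end

section
/- If (G,P) is quasi-lattice ordered, then: (a) 𝒥 = {pP : p ∈ P} ∪ {∅}; (b) 𝒥 is independent; (c) P ⊆ G satisfies the Toeplitz condition — indeed, for every g ∈ G with {x ∈ P : gx ∈ P} ≠ ∅ there exist p, q ∈ P with g = pq⁻¹ and {x ∈ P : gx ∈ P} = qP. -/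
variable {G : Type*} [Group G]

theorem self_mem_lmul (P : Submonoid G) (p : G) : p ∈ lmul p (P : Set G) := by
  simp [mem_lmul]

theorem lmul_subset_lmul_of_mem {P : Submonoid G} {p q : G} (h : p ∈ lmul q (P : Set G)) :
    lmul p (P : Set G) ⊆ lmul q (P : Set G) := by
  intro x hx
  rw [mem_lmul] at *
  simpa [mul_assoc] using P.mul_mem h hx

theorem lmul_subset_of_mem {P : Submonoid G} {p : G} (hp : p ∈ P) :
    lmul p (P : Set G) ⊆ P := by
  rintro _ ⟨y, hy, rfl⟩
  exact P.mul_mem hp hy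

theorem presub_eq_inter (P : Submonoid G) (p : G) (X : Set G) :
    presub P p X = (P : Set G) ∩ lmul p⁻¹ X := by
  ext x
  simp [presub, mem_lmul]

theorem setOf_mem_and_mul_mem_eq_inter (P : Submonoid G) (g : G) :
    {x : G | x ∈ P ∧ g * x ∈ P} = (P : Set G) ∩ lmul g⁻¹ (P : Set G) :=
  presub_eq_inter P g P

theorem setOf_isConstructible_eq (P : Submonoid G)
    (hQL : ∀ g : G, (P : Set G) ∩ lmul g (P : Set G) = ∅ ∨
      ∃ p ∈ P, (P : Set G) ∩ lmul g (P : Set G) = lmul p (P : Set G)) :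
    {X : Set G | IsConstructible P X} =
      {X : Set G | ∃ p ∈ P, X = lmul p (P : Set G)} ∪ {(∅ : Set G)} := by
  ext X
  constructor
  · intro hX
    induction hX with
    | empty => exact Or.inr rfl
    | base => exact Or.inl ⟨1, P.one_mem, by ext x; simp [mem_lmul]⟩
    | @mul p hp X hX ih =>
      rcases ih with ⟨q, hq, rfl⟩ | rfl
      · exact Or.inl ⟨p * q, P.mul_mem hp hq, lmul_lmul p q P⟩
      · exact Or.inr (lmul_empty p)
    | @pre p hp X hX ih =>
      rw [presub_eq_inter]
      rcases ih with ⟨q, hq, rfl⟩ | rfl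
      · rw [lmul_lmul]
        exact (hQL (p⁻¹ * q)).symm
      · exact Or.inr (by simp [lmul_empty])
  · rintro (⟨p, hp, rfl⟩ | rfl)
    · exact .mul hp .base
    · exact .empty

/-- The principal right ideals of a submonoid, together with `∅`, form an independent family. -/
theorem isIndepFamily_principal (P : Submonoid G) :
    IsIndepFamily ({X : Set G | ∃ p ∈ P, X = lmul p (P : Set G)} ∪ {(∅ : Set G)}) := by
  rintro X hX n hn Xs hXs hU
  rcases hX with ⟨p, -, rfl⟩ | rfl
  · obtain ⟨i, hi⟩ := Set.mem_iUnion.1 (hU ▸ self_mem_lmul P p)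
    refine ⟨i, Set.Subset.antisymm ?_ (hU ▸ Set.subset_iUnion Xs i)⟩
    rcases hXs i with ⟨q, -, hq⟩ | h0
    · rw [hq] at hi ⊢
      exact lmul_subset_lmul_of_mem hi
    · rw [Set.mem_singleton_iff.1 h0] at hi
      exact hi.elim
  · exact ⟨⟨0, hn⟩, (Set.iUnion_eq_empty.1 hU.symm _).symm⟩

theorem exists_eq_mul_inv_of_nonempty (P : Submonoid G)
    (hQL : ∀ g : G, (P : Set G) ∩ lmul g (P : Set G) = ∅ ∨
      ∃ p ∈ P, (P : Set G) ∩ lmul g (P : Set G) = lmul p (P : Set G))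
    (g : G) (hg : {x : G | x ∈ P ∧ g * x ∈ P}.Nonempty) :
    ∃ p ∈ P, ∃ q ∈ P, g = p * q⁻¹ ∧
      {x : G | x ∈ P ∧ g * x ∈ P} = lmul q (P : Set G) := by
  have h := hQL g⁻¹
  rw [← setOf_mem_and_mul_mem_eq_inter] at h
  rcases h with h | ⟨q, hq, h⟩
  · exact absurd h hg.ne_empty
  · have hmem : q ∈ {x : G | x ∈ P ∧ g * x ∈ P} := h ▸ self_mem_lmul P q
    exact ⟨g * q, hmem.2, q, hq, by simp, h⟩

theorem isToeplitz_of_exists_eq_mul_inv (P : Submonoid G)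
    (h : ∀ g : G, {x : G | x ∈ P ∧ g * x ∈ P}.Nonempty →
      ∃ p ∈ P, ∃ q ∈ P, g = p * q⁻¹ ∧
        {x : G | x ∈ P ∧ g * x ∈ P} = lmul q (P : Set G)) :
    IsToeplitz P := by
  intro g hg
  obtain ⟨p, hp, q, hq, hgpq, hS⟩ := h g hg
  refine ⟨[(1, p), (q, 1)], by simp, by simp [hp, hq], by simp [hgpq], ?_⟩
  have hP : presub P p (lmul 1 (P : Set G)) = P := by
    ext x
    simpa [presub, mem_lmul] using P.mul_mem hp
  have hqP : presub P 1 (lmul q (P : Set G)) = lmul q (P : Set G) := by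
    ext x
    simpa [presub] using fun hx => lmul_subset_of_mem hq hx
  rw [hS, List.foldl_cons, List.foldl_cons, List.foldl_nil, hP, hqP]

/-- If `(G,P)` is quasi-lattice ordered then (a) `𝒥 = {pP : p ∈ P} ∪ {∅}`, (b) `𝒥` is
independent, and (c) `P ⊆ G` is Toeplitz; indeed for every `g` with
`{x ∈ P : gx ∈ P} ≠ ∅` there are `p, q ∈ P` with `g = pq⁻¹` and `{x ∈ P : gx ∈ P} = qP`. -/
theorem stmt_17 (P : Submonoid G)
    (hQL0 : ∀ g : G, g ∈ P → g⁻¹ ∈ P → g = 1)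
    (hQL1 : ∀ g : G, (P : Set G) ∩ lmul g (P : Set G) = ∅ ∨
      ∃ p ∈ P, (P : Set G) ∩ lmul g (P : Set G) = lmul p (P : Set G)) :
    ({X : Set G | IsConstructible P X} =
        {X : Set G | ∃ p ∈ P, X = lmul p (P : Set G)} ∪ {(∅ : Set G)}) ∧
      IsIndepFamily {X : Set G | IsConstructible P X} ∧
      IsToeplitz P ∧
      ∀ g : G, {x : G | x ∈ P ∧ g * x ∈ P}.Nonempty →
        ∃ p ∈ P, ∃ q ∈ P, g = p * q⁻¹ ∧
          {x : G | x ∈ P ∧ g * x ∈ P} = lmul q (P : Set G) := by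
  have hJ := setOf_isConstructible_eq P hQL1
  have hd := exists_eq_mul_inv_of_nonempty P hQL1
  refine ⟨hJ, ?_, isToeplitz_of_exists_eq_mul_inv P hd, hd⟩
  rw [hJ]
  exact isIndepFamily_principal P
end

section
/- Assume 𝒥 is independent. Then Σ is a compact Hausdorff topological space. -/
variable {G : Type*} [Group G]

theorem IsConstructible.subset_s19 {P : Submonoid G} {X : Set G} (hX : IsConstructible P X) :
    X ⊆ (P : Set G) := by
  induction hX with
  | empty => exact Set.empty_subset _
  | base => exact subset_rfl
  | mul hp _ ih =>
    rintro _ ⟨x, hx, rfl⟩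
    exact P.mul_mem hp (ih hx)
  | pre _ _ _ => exact fun _ hy => hy.1

theorem chiF_setOf {α : Type*} (f : Set α → Bool) : chiF {X | f X = true} = f := by
  funext X
  rw [Bool.eq_iff_iff, chiF_eq_true, Set.mem_ofPred_eq]

theorem chiF_injective {α : Type*} : Function.Injective (chiF (α := α)) := fun F F' h => by
  ext X
  rw [← chiF_eq_true, h, chiF_eq_true]

theorem isClopen_setOf_apply_eq_true {ι : Type*} (i : ι) :
    IsClopen {f : ι → Bool | f i = true} :=
  (isClopen_discrete {true}).preimage (continuous_apply i)

/-- A family of subsets of `α`, given by its indicator function, being a filter is a closed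
condition. -/
theorem isClosed_setOf_isFilterOn {α : Type*} (J : Set (Set α)) :
    IsClosed {f : Set α → Bool | IsFilterOn J {X | f X = true}} := by
  simp only [IsFilterOn, Set.subset_def, Set.mem_ofPred_eq]
  refine .and ?_ (.and ?_ (.and ?_ ?_))
  · simp only [Set.ofPred_forall]
    exact isClosed_iInter fun X =>
      isClosed_imp (isClopen_setOf_apply_eq_true X).isOpen isClosed_const
  · simp only [Set.ofPred_forall]
    exact isClosed_iInter fun X => isClosed_imp (isClopen_setOf_apply_eq_true X).isOpen <| by
      simp only [Set.ofPred_forall]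
      exact isClosed_iInter fun Y => isClosed_iInter fun _ => isClosed_iInter fun _ =>
        (isClopen_setOf_apply_eq_true Y).isClosed
  · simp only [Set.ofPred_forall]
    exact isClosed_iInter fun X => isClosed_imp (isClopen_setOf_apply_eq_true X).isOpen <| by
      simp only [Set.ofPred_forall]
      exact isClosed_iInter fun Y =>
        isClosed_imp (isClopen_setOf_apply_eq_true Y).isOpen
          (isClopen_setOf_apply_eq_true _).isClosed
  · exact (isClopen_setOf_apply_eq_true ∅).isOpen.isClosed_compl

/-- A filter of constructible ideals is nonempty if and only if it contains `P`. -/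
theorem IsFilterOn.nonempty_iff {P : Submonoid G} {F : Set (Set G)}
    (hF : IsFilterOn {X : Set G | IsConstructible P X} F) : F.Nonempty ↔ (P : Set G) ∈ F :=
  ⟨fun ⟨X, hX⟩ => hF.2.1 X hX _ .base (hF.1 hX).subset_s19, fun h => ⟨_, h⟩⟩

theorem SigmaT.isClosedEmbedding_chiF (P : Submonoid G) :
    Topology.IsClosedEmbedding (fun F : SigmaT P => chiF F.1) := by
  refine ⟨⟨⟨rfl⟩, fun F F' h => Subtype.ext (chiF_injective h)⟩, ?_⟩
  have hrange : Set.range (fun F : SigmaT P => chiF F.1) =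
      {f | IsFilterOn {X : Set G | IsConstructible P X} {X | f X = true}} ∩
        {f | f (P : Set G) = true} := by
    ext f
    constructor
    · rintro ⟨⟨F, hF, hne⟩, rfl⟩
      simp only [Set.mem_inter_iff, Set.mem_ofPred_eq, chiF_eq_true, Set.ofPred_mem_eq]
      exact ⟨hF, hF.nonempty_iff.1 hne⟩
    · rintro ⟨hF, hP⟩
      exact ⟨⟨_, hF, _, hP⟩, chiF_setOf f⟩
  rw [hrange]
  exact (isClosed_setOf_isFilterOn _).inter (isClopen_setOf_apply_eq_true _).isClosed

/-- If `𝒥` is independent, then `Σ` is a compact Hausdorff space. -/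
theorem stmt_19 (P : Submonoid G)
    (hind : IsIndepFamily {X : Set G | IsConstructible P X}) :
    CompactSpace (SigmaT P) ∧ T2Space (SigmaT P) :=
  ⟨(SigmaT.isClosedEmbedding_chiF P).compactSpace,
    (SigmaT.isClosedEmbedding_chiF P).isEmbedding.t2Space⟩
end
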